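/- Fix τ ∈ ℂ with Im τ > 0 and set q = exp(iπτ), Λ = ℤ + τℤ. For every z ∈ ℂ, σ(2z, τ) = (2 / (π·θ₂(0|τ)²·θ₃(0|τ)²·θ₄(0|τ)²)) · exp(2δ₂(τ)z²) · θ₁(πz|τ)·θ₂(πz|τ)·θ₃(πz|τ)·θ₄(πz|τ). -/

import Mathlib

/-- Jacobi theta function θ₁(z|τ), nome q = exp(iπτ). -/
noncomputable def theta1 (z τ : ℂ) : ℂ :=
  2 * ∑' n : ℕ, (-1) ^ n * Complex.exp (Real.pi * Complex.I * τ * ((n : ℂ) + 1 / 2) ^ 2) *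
      Complex.sin ((2 * (n : ℂ) + 1) * z)

/-- Jacobi theta function θ₂(z|τ). -/
noncomputable def theta2 (z τ : ℂ) : ℂ :=
  2 * ∑' n : ℕ, Complex.exp (Real.pi * Complex.I * τ * ((n : ℂ) + 1 / 2) ^ 2) *
      Complex.cos ((2 * (n : ℂ) + 1) * z)

/-- Jacobi theta function θ₃(z|τ). -/
noncomputable def theta3 (z τ : ℂ) : ℂ :=
  1 + 2 * ∑' n : ℕ, Complex.exp (Real.pi * Complex.I * τ * ((n : ℂ) + 1) ^ 2) *
      Complex.cos (2 * ((n : ℂ) + 1) * z)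

/-- Jacobi theta function θ₄(z|τ). -/
noncomputable def theta4 (z τ : ℂ) : ℂ :=
  1 + 2 * ∑' n : ℕ, (-1) ^ (n + 1) * Complex.exp (Real.pi * Complex.I * τ * ((n : ℂ) + 1) ^ 2) *
      Complex.cos (2 * ((n : ℂ) + 1) * z)

/-- Weierstrass sigma function for the lattice ℤ·g₁ + ℤ·g₂. -/
noncomputable def wSigma (g1 g2 z : ℂ) : ℂ :=
  z * ∏' p : {p : ℤ × ℤ // p ≠ 0},
      ((1 - z / ((p.1.1 : ℂ) * g1 + (p.1.2 : ℂ) * g2)) *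
        Complex.exp (z / ((p.1.1 : ℂ) * g1 + (p.1.2 : ℂ) * g2) +
          z ^ 2 / (2 * ((p.1.1 : ℂ) * g1 + (p.1.2 : ℂ) * g2) ^ 2)))

/-- The iterated Eisenstein sum δ₂(τ) (inner sum over m first, then over n). -/
noncomputable def delta2 (τ : ℂ) : ℂ :=
  ∑' n : ℤ, ∑' m : ℤ, if (m, n) = ((0 : ℤ), (0 : ℤ)) then 0 else 1 / ((m : ℂ) + (n : ℂ) * τ) ^ 2

open Complex Filter Topology Finset Real

/-- The finite Euler product `∏_{k=1}^{N} (1 - Q ^ k)`. -/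
noncomputable def eulerProd (Q : ℂ) (N : ℕ) : ℂ := ∏ k ∈ range N, (1 - Q ^ (k + 1))

/-- The reciprocal of `eulerProd Q j`, extended by zero to negative `j`. -/
noncomputable def invEulerProd (Q : ℂ) (j : ℤ) : ℂ :=
  if j < 0 then 0 else (eulerProd Q j.toNat)⁻¹

lemma one_sub_pow_ne_zero {Q : ℂ} (hQ : ‖Q‖ < 1) (k : ℕ) : 1 - Q ^ (k + 1) ≠ 0 := by
  intro h
  have h1 : ‖Q ^ (k + 1)‖ = 1 := by rw [← sub_eq_zero.mp h, norm_one]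
  rw [norm_pow] at h1
  exact (pow_lt_one₀ (norm_nonneg Q) hQ k.succ_ne_zero).ne h1

lemma eulerProd_ne_zero {Q : ℂ} (hQ : ‖Q‖ < 1) (N : ℕ) : eulerProd Q N ≠ 0 :=
  prod_ne_zero_iff.mpr fun k _ ↦ one_sub_pow_ne_zero hQ k

lemma invEulerProd_sub_one {Q : ℂ} (hQ : ‖Q‖ < 1) (j : ℤ) :
    invEulerProd Q (j - 1) = (1 - Q ^ j) * invEulerProd Q j := by
  rcases lt_trichotomy j 0 with h | rfl | h
  · simp [invEulerProd, h, show j < 1 by lia]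
  · simp [invEulerProd]
  · obtain ⟨n, rfl⟩ : ∃ n : ℕ, j = n + 1 := ⟨(j - 1).toNat, by lia⟩
    have h0 := eulerProd_ne_zero hQ n
    have h1 := one_sub_pow_ne_zero hQ n
    have e1 : ¬ ((n : ℤ) < 0) := by lia
    have e2 : ¬ ((n : ℤ) + 1 < 0) := by lia
    have e3 : ((n : ℤ) + 1).toNat = n + 1 := by lia
    have e4 : Q ^ ((n : ℤ) + 1) = Q ^ (n + 1) := by norm_cast
    simp only [invEulerProd, add_sub_cancel_right, if_neg e1, if_neg e2, Int.toNat_natCast, e3, e4]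
    rw [show eulerProd Q (n + 1) = eulerProd Q n * (1 - Q ^ (n + 1)) from prod_range_succ _ _]
    field_simp

/-- The finite form of the coefficients in the Jacobi triple product: a Gaussian binomial. -/
noncomputable def tripleCoeff (Q : ℂ) (N : ℕ) (j : ℤ) : ℂ :=
  eulerProd Q (2 * N) * (invEulerProd Q (N + j) * invEulerProd Q (N - j))

lemma tripleCoeff_eq_zero (Q : ℂ) (N : ℕ) {j : ℤ} (hj : j ∉ Icc (-N : ℤ) N) :
    tripleCoeff Q N j = 0 := by
  simp only [Finset.mem_Icc, not_and_or, not_le] at hj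
  rcases hj with h | h
  · simp [tripleCoeff, invEulerProd, show (N : ℤ) + j < 0 by lia]
  · simp [tripleCoeff, invEulerProd, h]

lemma tripleCoeff_succ {q : ℂ} (hq0 : q ≠ 0) (hq : ‖q ^ 2‖ < 1) (N : ℕ) (j : ℤ) :
    tripleCoeff (q ^ 2) (N + 1) j * q ^ (j ^ 2) =
      (1 + q ^ (4 * N + 2)) * (tripleCoeff (q ^ 2) N j * q ^ (j ^ 2)) +
      q ^ (2 * N + 1) * (tripleCoeff (q ^ 2) N (j - 1) * q ^ ((j - 1) ^ 2) +
        tripleCoeff (q ^ 2) N (j + 1) * q ^ ((j + 1) ^ 2)) := by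
  set Q := q ^ 2 with hQ
  have hQ0 : Q ≠ 0 := pow_ne_zero _ hq0
  set A := invEulerProd Q (N + 1 + j) with hA
  set B := invEulerProd Q (N + 1 - j) with hB
  have a1 : invEulerProd Q (N + j) = (1 - Q ^ ((N : ℤ) + 1 + j)) * A := by
    rw [← invEulerProd_sub_one hq]; ring_nf
  have b1 : invEulerProd Q (N - j) = (1 - Q ^ ((N : ℤ) + 1 - j)) * B := by
    rw [← invEulerProd_sub_one hq]; ring_nf
  have a2 : invEulerProd Q (N + (j - 1)) = (1 - Q ^ ((N : ℤ) + j)) * invEulerProd Q (N + j) := by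
    rw [← invEulerProd_sub_one hq]; ring_nf
  have b2 : invEulerProd Q (N - (j + 1)) = (1 - Q ^ ((N : ℤ) - j)) * invEulerProd Q (N - j) := by
    rw [← invEulerProd_sub_one hq]; ring_nf
  have hP : eulerProd Q (2 * (N + 1)) =
      eulerProd Q (2 * N) * (1 - Q ^ (2 * N + 1)) * (1 - Q ^ (2 * N + 1 + 1)) := by
    rw [mul_add, mul_one, eulerProd, prod_range_succ, prod_range_succ]; rfl
  simp only [tripleCoeff]
  rw [a2, b2, a1, b1, hP, show (N : ℤ) - (j - 1) = N + 1 - j by ring,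
    show (N : ℤ) + (j + 1) = N + 1 + j by ring, ← hA, ← hB]
  push_cast
  rw [← hA, ← hB]
  set t := q ^ j with ht
  have ht0 : t ≠ 0 := zpow_ne_zero _ hq0
  set M := q ^ N with hM
  have e1 : q ^ ((j - 1) ^ 2) = q ^ (j ^ 2) * q / t ^ 2 := by
    rw [show (j - 1) ^ 2 = j ^ 2 + 1 - j * 2 by ring, zpow_sub₀ hq0, zpow_add₀ hq0, zpow_mul]
    simp [ht]
  have e2 : q ^ ((j + 1) ^ 2) = q ^ (j ^ 2) * q * t ^ 2 := by
    rw [show (j + 1) ^ 2 = j ^ 2 + 1 + j * 2 by ring, zpow_add₀ hq0, zpow_add₀ hq0, zpow_mul]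
    simp [ht]
  have e3 : Q ^ j = t ^ 2 := by rw [hQ, ht, ← zpow_natCast, ← zpow_natCast, ← zpow_mul,
    ← zpow_mul, mul_comm]
  have e4 : Q ^ (N : ℤ) = M ^ 2 := by rw [hQ, hM, zpow_natCast, ← pow_mul, ← pow_mul, mul_comm]
  have e5 : Q ^ N = M ^ 2 := by rw [← e4, zpow_natCast]
  rw [e1, e2, zpow_add₀ hQ0, zpow_sub₀ hQ0, zpow_add₀ hQ0, zpow_add₀ hQ0, zpow_sub₀ hQ0, e3, e4,
    zpow_one, show 4 * N + 2 = N * 4 + 2 by ring, show 2 * N + 1 = N * 2 + 1 by ring, pow_add q,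
    pow_add q, pow_succ Q (N * 2 + 1), pow_add Q, pow_mul, pow_mul, pow_mul, e5, ← hM, hQ]
  field_simp
  ring

lemma hasSum_tripleCoeff {q x : ℂ} (hq0 : q ≠ 0) (hq : ‖q ^ 2‖ < 1) (hx : x ≠ 0) (N : ℕ) :
    HasSum (fun j : ℤ ↦ tripleCoeff (q ^ 2) N j * q ^ (j ^ 2) * x ^ j)
      (∏ k ∈ range N, ((1 + q ^ (2 * k + 1) * x) * (1 + q ^ (2 * k + 1) / x))) := by
  induction N with
  | zero =>
    convert hasSum_single (0 : ℤ) fun j hj ↦ ?_ using 1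
    · simp [tripleCoeff, invEulerProd, eulerProd]
    · rw [tripleCoeff_eq_zero _ _ (by simpa using hj)]; simp
  | succ N ih =>
    have h1 := (Equiv.subRight (1 : ℤ)).hasSum_iff.mpr ih
    have h2 := (Equiv.addRight (1 : ℤ)).hasSum_iff.mpr ih
    rw [prod_range_succ]
    have h := (ih.mul_left (1 + q ^ (4 * N + 2))).add
      ((h1.mul_left (q ^ (2 * N + 1) * x)).add (h2.mul_left (q ^ (2 * N + 1) / x)))
    have hv : ∀ p : ℂ, p * ((1 + q ^ (2 * N + 1) * x) * (1 + q ^ (2 * N + 1) / x)) =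
        (1 + q ^ (4 * N + 2)) * p +
          (q ^ (2 * N + 1) * x * p + q ^ (2 * N + 1) / x * p) := fun p ↦ by
      rw [show 4 * N + 2 = (2 * N + 1) * 2 by ring, pow_mul]
      field_simp
      ring
    rw [hv]
    refine (congrArg (HasSum · _) (funext fun j ↦ ?_)).mpr h
    simp only [Function.comp_apply, Equiv.coe_addRight, Equiv.subRight_apply]
    rw [tripleCoeff_succ hq0 hq, zpow_sub₀ hx, zpow_add₀ hx, zpow_one]
    field_simp

lemma norm_nome_sq_lt_one {τ : ℂ} (hτ : 0 < τ.im) : ‖cexp (π * I * τ) ^ 2‖ < 1 := by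
  rw [norm_pow]
  refine pow_lt_one₀ (norm_nonneg _) ?_ two_ne_zero
  rw [Complex.norm_exp, Real.exp_lt_one_iff]
  simp
  positivity

lemma exists_tendsto_eulerProd {Q : ℂ} (hQ : ‖Q‖ < 1) :
    ∃ G : ℂ, G ≠ 0 ∧ Tendsto (eulerProd Q) atTop (𝓝 G) := by
  refine ⟨∏' n : ℕ, (1 - Q ^ (n + 1)), ?_,
    (ModularForm.multipliable_one_sub_pow hQ).hasProd.tendsto_prod_nat⟩
  simp_rw [sub_eq_add_neg]
  refine tprod_one_add_ne_zero_of_summable (f := fun n ↦ -Q ^ (n + 1)) (fun n ↦ ?_) ?_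
  · rw [← sub_eq_add_neg]; exact one_sub_pow_ne_zero hQ n
  · simpa [norm_pow, pow_succ] using
      (summable_geometric_of_lt_one (norm_nonneg Q) hQ).mul_right ‖Q‖

lemma tendsto_eulerProd_mul_tripleCoeff {Q : ℂ} (hQ : ‖Q‖ < 1) (j : ℤ) :
    Tendsto (fun N : ℕ ↦ eulerProd Q N * tripleCoeff Q N j) atTop (𝓝 1) := by
  obtain ⟨G, hG, h⟩ := exists_tendsto_eulerProd hQ
  have key (i : ℤ) : Tendsto (fun N : ℕ ↦ invEulerProd Q (N + i)) atTop (𝓝 G⁻¹) := by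
    have h1 : Tendsto (fun N : ℕ ↦ ((N : ℤ) + i).toNat) atTop atTop := by
      refine tendsto_atTop.mpr fun b ↦ ?_
      filter_upwards [eventually_ge_atTop (b + i.natAbs)] with N hN
      lia
    refine ((h.comp h1).inv₀ hG).congr' ?_
    filter_upwards [eventually_ge_atTop i.natAbs] with N hN
    rw [invEulerProd, if_neg (by lia)]
    rfl
  have h2 : Tendsto (fun N : ℕ ↦ eulerProd Q (2 * N)) atTop (𝓝 G) :=
    h.comp (tendsto_id.const_mul_atTop' two_pos)
  have := h.mul (h2.mul ((key j).mul (key (-j))))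
  simpa only [tripleCoeff, sub_eq_add_neg, show G * (G * (G⁻¹ * G⁻¹)) = 1 by field_simp] using this

lemma exists_norm_eulerProd_mul_tripleCoeff_le {Q : ℂ} (hQ : ‖Q‖ < 1) :
    ∃ C : ℝ, ∀ (N : ℕ) (j : ℤ), ‖eulerProd Q N * tripleCoeff Q N j‖ ≤ C := by
  obtain ⟨G, hG, h⟩ := exists_tendsto_eulerProd hQ
  obtain ⟨A, hA⟩ := h.norm.bddAbove_range
  obtain ⟨B, hB⟩ := (h.inv₀ hG).norm.bddAbove_range
  simp only [upperBounds, Set.mem_range, forall_exists_index, forall_apply_eq_imp_iff,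
    Set.mem_ofPred_eq] at hA hB
  have hA0 : 0 ≤ A := (norm_nonneg _).trans (hA 0)
  have hB0 : 0 ≤ B := (norm_nonneg _).trans (hB 0)
  have hi (j : ℤ) : ‖invEulerProd Q j‖ ≤ B := by
    unfold invEulerProd
    split_ifs
    · simpa using hB0
    · exact hB _
  refine ⟨A * (A * (B * B)), fun N j ↦ ?_⟩
  simp only [tripleCoeff, norm_mul]
  gcongr
  exacts [hA _, hA _, hi _, hi _]

/-- The Jacobi triple product, as a limit of finite products. -/
theorem tendsto_jacobi_triple_product {τ : ℂ} (hτ : 0 < τ.im) (z : ℂ) :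
    Tendsto (fun N : ℕ ↦ eulerProd (cexp (π * I * τ) ^ 2) N *
      ∏ k ∈ range N, ((1 + cexp (π * I * τ) ^ (2 * k + 1) * cexp (2 * π * I * z)) *
        (1 + cexp (π * I * τ) ^ (2 * k + 1) / cexp (2 * π * I * z)))) atTop
      (𝓝 (jacobiTheta₂ z τ)) := by
  have hq := norm_nome_sq_lt_one hτ
  set q := cexp (π * I * τ) with hqdef
  set x := cexp (2 * π * I * z) with hxdef
  have hq0 : q ≠ 0 := exp_ne_zero _
  have hterm (j : ℤ) : jacobiTheta₂_term j z τ = q ^ (j ^ 2) * x ^ j := by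
    rw [jacobiTheta₂_term, hqdef, hxdef, ← exp_int_mul, ← exp_int_mul, ← Complex.exp_add]
    push_cast
    ring_nf
  obtain ⟨C, hC⟩ := exists_norm_eulerProd_mul_tripleCoeff_le hq
  have hsum : Summable fun j : ℤ ↦ C * ‖jacobiTheta₂_term j z τ‖ :=
    ((summable_jacobiTheta₂_term_iff z τ).mpr hτ).norm.mul_left C
  refine (tendsto_tsum_of_dominated_convergence (𝓕 := atTop)
    (f := fun (N : ℕ) (j : ℤ) ↦ eulerProd (q ^ 2) N * tripleCoeff (q ^ 2) N j *
      jacobiTheta₂_term j z τ) hsum (fun j ↦ ?_) (.of_forall fun N j ↦ ?_)).congr fun N ↦ ?_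
  · simpa using (tendsto_eulerProd_mul_tripleCoeff hq j).mul_const (jacobiTheta₂_term j z τ)
  · rw [norm_mul]
    gcongr
    exact hC N j
  · rw [← (hasSum_tripleCoeff hq0 hq (exp_ne_zero _) N).tsum_eq, ← tsum_mul_left]
    refine tsum_congr fun j ↦ ?_
    rw [hterm]
    ring

lemma summable_jacobiTheta₂_term_nat {τ : ℂ} (hτ : 0 < τ.im) (z : ℂ) :
    Summable fun n : ℕ ↦ jacobiTheta₂_term n z τ :=
  ((summable_jacobiTheta₂_term_iff z τ).mpr hτ).comp_injective Nat.cast_injective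

lemma summable_jacobiTheta₂_term_nat_add_one {τ : ℂ} (hτ : 0 < τ.im) (z : ℂ) :
    Summable fun n : ℕ ↦ jacobiTheta₂_term (n + 1) z τ :=
  ((summable_jacobiTheta₂_term_iff z τ).mpr hτ).comp_injective
    (i := fun n : ℕ ↦ (n + 1 : ℤ)) fun a b h ↦ by simpa using h

lemma summable_jacobiTheta₂_term_neg_nat_add_one {τ : ℂ} (hτ : 0 < τ.im) (z : ℂ) :
    Summable fun n : ℕ ↦ jacobiTheta₂_term (-(n + 1)) z τ :=
  ((summable_jacobiTheta₂_term_iff z τ).mpr hτ).comp_injective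
    (i := fun n : ℕ ↦ (-(n + 1) : ℤ)) fun a b h ↦ by simpa using h

lemma jacobiTheta₂_eq_one_add_tsum {τ : ℂ} (hτ : 0 < τ.im) (z : ℂ) :
    jacobiTheta₂ z τ =
      1 + ∑' n : ℕ, (jacobiTheta₂_term (n + 1) z τ + jacobiTheta₂_term (-(n + 1)) z τ) := by
  rw [jacobiTheta₂, tsum_of_add_one_of_neg_add_one
    (f := fun n : ℤ ↦ jacobiTheta₂_term n z τ) (summable_jacobiTheta₂_term_nat_add_one hτ z)
    (summable_jacobiTheta₂_term_neg_nat_add_one hτ z),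
    (summable_jacobiTheta₂_term_nat_add_one hτ z).tsum_add
      (summable_jacobiTheta₂_term_neg_nat_add_one hτ z)]
  simp only [jacobiTheta₂_term, Int.cast_zero, mul_zero, zero_mul, ne_eq, OfNat.ofNat_ne_zero,
    not_false_eq_true, zero_pow, add_zero, Complex.exp_zero]
  ring

lemma jacobiTheta₂_eq_tsum_nat {τ : ℂ} (hτ : 0 < τ.im) (z : ℂ) :
    jacobiTheta₂ z τ =
      ∑' n : ℕ, (jacobiTheta₂_term n z τ + jacobiTheta₂_term (-(n + 1)) z τ) := by
  rw [jacobiTheta₂, tsum_of_nat_of_neg_add_one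
    (f := fun n : ℤ ↦ jacobiTheta₂_term n z τ) (summable_jacobiTheta₂_term_nat hτ z)
    (summable_jacobiTheta₂_term_neg_nat_add_one hτ z),
    (summable_jacobiTheta₂_term_nat hτ z).tsum_add
      (summable_jacobiTheta₂_term_neg_nat_add_one hτ z)]

lemma cexp_pi_mul_I_mul_nat (n : ℕ) : cexp (π * I * n) = (-1) ^ n := by
  rw [mul_comm, Complex.exp_nat_mul, Complex.exp_pi_mul_I]

lemma theta3_eq_jacobiTheta₂ {τ : ℂ} (hτ : 0 < τ.im) (z : ℂ) :
    theta3 (π * z) τ = jacobiTheta₂ z τ := by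
  rw [theta3, jacobiTheta₂_eq_one_add_tsum hτ, ← tsum_mul_left]
  congr 1
  refine tsum_congr fun n ↦ ?_
  rw [jacobiTheta₂_term, jacobiTheta₂_term, Complex.cos, ← mul_assoc, mul_comm 2, mul_assoc,
    mul_div_cancel₀ _ two_ne_zero, mul_add, ← Complex.exp_add, ← Complex.exp_add]
  push_cast
  congr 2 <;> ring

lemma theta4_eq_jacobiTheta₂ {τ : ℂ} (hτ : 0 < τ.im) (z : ℂ) :
    theta4 (π * z) τ = jacobiTheta₂ (z + 1 / 2) τ := by
  rw [theta4, jacobiTheta₂_eq_one_add_tsum hτ, ← tsum_mul_left]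
  congr 1
  refine tsum_congr fun n ↦ ?_
  have h2 : ((-1 : ℂ)) ^ (n + 1) = cexp (-(π * I * (n + 1 : ℕ))) := by
    rw [Complex.exp_neg, cexp_pi_mul_I_mul_nat, ← inv_pow]; norm_num
  rw [jacobiTheta₂_term, jacobiTheta₂_term, Complex.cos, ← mul_assoc, mul_comm 2,
    mul_assoc _ (2 : ℂ), mul_div_cancel₀ _ two_ne_zero, mul_add]
  nth_rw 1 [← cexp_pi_mul_I_mul_nat]
  rw [h2]
  simp only [← Complex.exp_add]
  push_cast
  congr 2 <;> ring

lemma theta2_eq_jacobiTheta₂ {τ : ℂ} (hτ : 0 < τ.im) (z : ℂ) :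
    theta2 (π * z) τ =
      cexp (π * I * τ / 4) * cexp (π * I * z) * jacobiTheta₂ (z + τ / 2) τ := by
  rw [theta2, jacobiTheta₂_eq_tsum_nat hτ, ← tsum_mul_left, ← tsum_mul_left]
  refine tsum_congr fun n ↦ ?_
  rw [jacobiTheta₂_term, jacobiTheta₂_term, Complex.cos, ← mul_assoc, mul_comm 2,
    mul_assoc _ (2 : ℂ), mul_div_cancel₀ _ two_ne_zero, mul_add, mul_add]
  simp only [← Complex.exp_add]
  push_cast
  congr 2 <;> ring

lemma theta1_eq_jacobiTheta₂ {τ : ℂ} (hτ : 0 < τ.im) (z : ℂ) :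
    theta1 (π * z) τ = -I *
      (cexp (π * I * τ / 4) * cexp (π * I * z) * jacobiTheta₂ (z + 1 / 2 + τ / 2) τ) := by
  rw [theta1, jacobiTheta₂_eq_tsum_nat hτ, ← tsum_mul_left, ← tsum_mul_left, ← tsum_mul_left]
  refine tsum_congr fun n ↦ ?_
  have h2 : ((-1 : ℂ)) ^ (n + 1) = cexp (-(π * I * (n + 1 : ℕ))) := by
    rw [Complex.exp_neg, cexp_pi_mul_I_mul_nat, ← inv_pow]; norm_num
  have a1 : cexp (π * I * τ / 4) * cexp (π * I * z) * jacobiTheta₂_term n (z + 1 / 2 + τ / 2) τ =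
      (-1) ^ n * (cexp (π * I * τ * ((n : ℂ) + 1 / 2) ^ 2) *
        cexp ((2 * n + 1) * (π * z) * I)) := by
    rw [← cexp_pi_mul_I_mul_nat, jacobiTheta₂_term]
    simp only [← Complex.exp_add]
    push_cast
    congr 1; ring
  have a2 : cexp (π * I * τ / 4) * cexp (π * I * z) *
      jacobiTheta₂_term (-(n + 1)) (z + 1 / 2 + τ / 2) τ =
      (-1) ^ (n + 1) * (cexp (π * I * τ * ((n : ℂ) + 1 / 2) ^ 2) *
        cexp (-((2 * n + 1) * (π * z)) * I)) := by
    rw [h2, jacobiTheta₂_term]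
    simp only [← Complex.exp_add]
    push_cast
    congr 1; ring
  rw [mul_add, a1, a2, Complex.sin]
  ring

/-- The finite product `∏_{k=1}^{N} (1 - Q ^ k * y) * (1 - Q ^ k / y)`. -/
noncomputable def evenProd (Q y : ℂ) (N : ℕ) : ℂ :=
  ∏ k ∈ range N, ((1 - Q ^ (k + 1) * y) * (1 - Q ^ (k + 1) / y))

/-- The finite product `∏_{k=1}^{N} (1 - q ^ (2 * k - 1) * y) * (1 - q ^ (2 * k - 1) / y)`. -/
noncomputable def oddProd (q y : ℂ) (N : ℕ) : ℂ :=
  ∏ k ∈ range N, ((1 - q ^ (2 * k + 1) * y) * (1 - q ^ (2 * k + 1) / y))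

lemma evenProd_mul_oddProd (q : ℂ) {y : ℂ} (hy : y ≠ 0) (N : ℕ) :
    evenProd (q ^ 2) y N * evenProd (q ^ 2) (-y) N * oddProd q y N * oddProd q (-y) N =
      evenProd (q ^ 2) (y ^ 2) (2 * N) := by
  induction N with
  | zero => simp [evenProd, oddProd]
  | succ N ih =>
    have h2 : 2 * (N + 1) = 2 * N + 1 + 1 := by ring
    simp only [evenProd, oddProd] at ih ⊢
    rw [h2, prod_range_succ _ (2 * N + 1), prod_range_succ _ (2 * N), ← ih]
    simp only [prod_range_succ _ N]
    field_simp
    ring_nf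

lemma eulerProd_sq_mul_evenProd_mul_oddProd (q : ℂ) (N : ℕ) :
    eulerProd (q ^ 2) N ^ 2 * evenProd (q ^ 2) (-1) N * oddProd q 1 N * oddProd q (-1) N =
      eulerProd (q ^ 2) (2 * N) ^ 2 := by
  induction N with
  | zero => simp [eulerProd, evenProd, oddProd]
  | succ N ih =>
    have h2 : 2 * (N + 1) = 2 * N + 1 + 1 := by ring
    simp only [eulerProd, evenProd, oddProd] at ih ⊢
    rw [h2, prod_range_succ _ (2 * N + 1), prod_range_succ _ (2 * N), mul_pow, mul_pow, ← ih]
    simp only [prod_range_succ _ N]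
    field_simp
    ring

lemma tendsto_theta3 {τ : ℂ} (hτ : 0 < τ.im) (z : ℂ) :
    Tendsto (fun N ↦ eulerProd (cexp (π * I * τ) ^ 2) N *
      oddProd (cexp (π * I * τ)) (-cexp (2 * π * I * z)) N) atTop (𝓝 (theta3 (π * z) τ)) := by
  rw [theta3_eq_jacobiTheta₂ hτ]
  refine (tendsto_jacobi_triple_product hτ z).congr fun N ↦ ?_
  simp [oddProd, div_neg]

lemma cexp_two_pi_mul_I_mul_add_half (z : ℂ) :
    cexp (2 * π * I * (z + 1 / 2)) = -cexp (2 * π * I * z) := by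
  rw [show 2 * π * I * (z + 1 / 2) = 2 * π * I * z + π * I by ring, Complex.exp_add,
    Complex.exp_pi_mul_I, mul_neg_one]

lemma tendsto_theta4 {τ : ℂ} (hτ : 0 < τ.im) (z : ℂ) :
    Tendsto (fun N ↦ eulerProd (cexp (π * I * τ) ^ 2) N *
      oddProd (cexp (π * I * τ)) (cexp (2 * π * I * z)) N) atTop (𝓝 (theta4 (π * z) τ)) := by
  rw [theta4_eq_jacobiTheta₂ hτ]
  refine (tendsto_jacobi_triple_product hτ (z + 1 / 2)).congr fun N ↦ ?_
  simp only [oddProd, cexp_two_pi_mul_I_mul_add_half, div_neg]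
  congr 1
  exact prod_congr rfl fun k _ ↦ by ring

lemma prod_one_add_mul_telescope (q : ℂ) (hq : q ≠ 0) {w : ℂ} (hw : w ≠ 0) (N : ℕ) :
    (∏ k ∈ range N, ((1 + q ^ (2 * k + 1) * (q * w)) * (1 + q ^ (2 * k + 1) / (q * w)))) *
      (1 + (q ^ 2) ^ N / w) = (1 + 1 / w) * evenProd (q ^ 2) (-w) N := by
  induction N with
  | zero => simp [evenProd]
  | succ N ih =>
    simp only [evenProd] at ih ⊢
    rw [prod_range_succ, prod_range_succ, ← mul_assoc (1 + 1 / w), ← ih]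
    field_simp
    ring_nf

lemma tendsto_jacobiTheta₂_add_half_period {τ : ℂ} (hτ : 0 < τ.im) (z : ℂ) :
    Tendsto (fun N ↦ eulerProd (cexp (π * I * τ) ^ 2) N *
      ((1 + 1 / cexp (2 * π * I * z)) *
        evenProd (cexp (π * I * τ) ^ 2) (-cexp (2 * π * I * z)) N)) atTop
      (𝓝 (jacobiTheta₂ (z + τ / 2) τ)) := by
  have h1 : Tendsto (fun N ↦ 1 + (cexp (π * I * τ) ^ 2) ^ N / cexp (2 * π * I * z)) atTop
      (𝓝 1) := by
    simpa using ((tendsto_pow_atTop_nhds_zero_of_norm_lt_one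
      (norm_nome_sq_lt_one hτ)).div_const (cexp (2 * π * I * z))).const_add 1
  have h2 := (tendsto_jacobi_triple_product hτ (z + τ / 2)).mul h1
  rw [mul_one] at h2
  refine h2.congr fun N ↦ ?_
  have h3 : cexp (2 * π * I * (z + τ / 2)) = cexp (π * I * τ) * cexp (2 * π * I * z) := by
    rw [← Complex.exp_add]; ring_nf
  rw [h3, mul_assoc, prod_one_add_mul_telescope _ (exp_ne_zero _) (exp_ne_zero _)]

lemma tendsto_theta2 {τ : ℂ} (hτ : 0 < τ.im) (z : ℂ) :
    Tendsto (fun N ↦ cexp (π * I * τ / 4) * cexp (π * I * z) *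
      (eulerProd (cexp (π * I * τ) ^ 2) N * ((1 + 1 / cexp (2 * π * I * z)) *
        evenProd (cexp (π * I * τ) ^ 2) (-cexp (2 * π * I * z)) N))) atTop
      (𝓝 (theta2 (π * z) τ)) := by
  rw [theta2_eq_jacobiTheta₂ hτ]
  exact (tendsto_jacobiTheta₂_add_half_period hτ z).const_mul _

lemma tendsto_theta1 {τ : ℂ} (hτ : 0 < τ.im) (z : ℂ) :
    Tendsto (fun N ↦ -I * (cexp (π * I * τ / 4) * cexp (π * I * z) *
      (eulerProd (cexp (π * I * τ) ^ 2) N * ((1 - 1 / cexp (2 * π * I * z)) *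
        evenProd (cexp (π * I * τ) ^ 2) (cexp (2 * π * I * z)) N)))) atTop
      (𝓝 (theta1 (π * z) τ)) := by
  rw [theta1_eq_jacobiTheta₂ hτ]
  refine (((tendsto_jacobiTheta₂_add_half_period hτ (z + 1 / 2)).const_mul _).const_mul _).congr
    fun N ↦ ?_
  rw [cexp_two_pi_mul_I_mul_add_half, neg_neg, div_neg, ← sub_eq_add_neg]

lemma theta2_mul_theta3_mul_theta4_zero {τ : ℂ} (hτ : 0 < τ.im) {G : ℂ}
    (hG : Tendsto (eulerProd (cexp (π * I * τ) ^ 2)) atTop (𝓝 G)) :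
    theta2 0 τ * theta3 0 τ * theta4 0 τ = 2 * cexp (π * I * τ / 4) * G ^ 3 := by
  have h2 := tendsto_theta2 hτ 0
  have h3 := tendsto_theta3 hτ 0
  have h4 := tendsto_theta4 hτ 0
  simp only [mul_zero, Complex.exp_zero, mul_one, div_one] at h2 h3 h4
  refine tendsto_nhds_unique ((h2.mul h3).mul h4) ?_
  have h5 : Tendsto (fun N : ℕ ↦ 2 * N) atTop atTop := tendsto_id.const_mul_atTop' two_pos
  refine (((hG.mul ((hG.comp h5).pow 2)).const_mul (2 * cexp (π * I * τ / 4))).congr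
    fun N ↦ ?_).trans_eq (by rw [pow_succ' G 2])
  rw [Function.comp_apply, ← eulerProd_sq_mul_evenProd_mul_oddProd]
  ring

lemma tendsto_theta_mul_theta_mul_theta_mul_theta {τ : ℂ} (hτ : 0 < τ.im) (z : ℂ) :
    Tendsto (fun N ↦ 2 * cexp (π * I * τ / 4) ^ 2 * sin (2 * π * z) *
      eulerProd (cexp (π * I * τ) ^ 2) N ^ 4 *
      evenProd (cexp (π * I * τ) ^ 2) (cexp (2 * π * I * (2 * z))) (2 * N)) atTop
      (𝓝 (theta1 (π * z) τ * theta2 (π * z) τ * theta3 (π * z) τ * theta4 (π * z) τ)) := by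
  refine ((((tendsto_theta1 hτ z).mul (tendsto_theta2 hτ z)).mul (tendsto_theta3 hτ z)).mul
    (tendsto_theta4 hτ z)).congr fun N ↦ ?_
  have hy : cexp (2 * π * I * (2 * z)) = cexp (2 * π * I * z) ^ 2 := by
    rw [← Complex.exp_nat_mul]; push_cast; ring_nf
  have hh : cexp (2 * π * I * z) = cexp (π * I * z) ^ 2 := by
    rw [← Complex.exp_nat_mul]; push_cast; ring_nf
  have hs : sin (2 * π * z) = -I / 2 * (cexp (2 * π * I * z) - 1 / cexp (2 * π * I * z)) := by
    rw [Complex.sin, one_div, ← Complex.exp_neg]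
    ring_nf
  rw [hy, ← evenProd_mul_oddProd _ (exp_ne_zero _), hs, hh]
  have h0 := exp_ne_zero (π * I * z)
  generalize cexp (π * I * z) = h at *
  field_simp
  ring

/-- The Weierstrass primary factor of genus two. -/
noncomputable def primaryFactor (u : ℂ) : ℂ := (1 - u) * cexp (u + u ^ 2 / 2)

lemma primaryFactor_zero : primaryFactor 0 = 1 := by simp [primaryFactor]

lemma hasDerivAt_primaryFactor (u : ℂ) :
    HasDerivAt primaryFactor (-u ^ 2 * cexp (u + u ^ 2 / 2)) u := by
  have h1 : HasDerivAt (fun v : ℂ ↦ v + v ^ 2 / 2) (1 + u) u :=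
    ((hasDerivAt_id' u).fun_add ((hasDerivAt_pow 2 u).div_const 2)).congr_deriv (by norm_num)
  exact (((hasDerivAt_id' u).const_sub 1).fun_mul h1.cexp).congr_deriv (by ring)

lemma norm_primaryFactor_sub_one_le {u : ℂ} (hu : ‖u‖ ≤ 1) :
    ‖primaryFactor u - 1‖ ≤ Real.exp 2 * ‖u‖ ^ 3 := by
  have h := (convex_closedBall (0 : ℂ) ‖u‖).norm_image_sub_le_of_norm_hasDerivWithin_le
    (f := primaryFactor) (C := Real.exp 2 * ‖u‖ ^ 2) (x := 0) (y := u)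
    (fun v _ ↦ (hasDerivAt_primaryFactor v).hasDerivWithinAt) (fun v hv ↦ ?_)
    (by simp) (by simp)
  · rw [primaryFactor_zero, sub_zero] at h
    exact h.trans_eq (by ring)
  · have hv' : ‖v‖ ≤ ‖u‖ := by simpa using hv
    rw [norm_mul, norm_neg, norm_pow, mul_comm]
    have hexp : ‖cexp (v + v ^ 2 / 2)‖ ≤ Real.exp 2 := by
      refine (Complex.norm_exp_le_exp_norm _).trans (Real.exp_le_exp.mpr ?_)
      have h1 : ‖v‖ ≤ 1 := hv'.trans hu
      have h2 : ‖v ^ 2 / 2‖ ≤ 1 := by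
        rw [norm_div, norm_pow, Complex.norm_ofNat]
        nlinarith [norm_nonneg v]
      linarith [norm_add_le v (v ^ 2 / 2)]
    gcongr

lemma summable_norm_lattice_inv_pow_three {τ : ℂ} (hτ : 0 < τ.im) :
    Summable fun p : ℤ × ℤ ↦ ‖((p.1 : ℂ) + p.2 * τ)⁻¹‖ ^ 3 := by
  have h := (summable_prod_eisSummand (k := 3) le_rfl ⟨τ, hτ⟩).norm
  rw [← (Equiv.prodComm ℤ ℤ).summable_iff] at h
  refine h.congr fun p ↦ ?_
  simp [EisensteinSeries.eisSummand, add_comm]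

lemma summable_norm_primaryFactor_sub_one {τ : ℂ} (hτ : 0 < τ.im) (z : ℂ) :
    Summable fun p : ℤ × ℤ ↦ ‖primaryFactor (z / ((p.1 : ℂ) + p.2 * τ)) - 1‖ := by
  have h := ((summable_norm_lattice_inv_pow_three hτ).mul_left (‖z‖ ^ 3))
  have hs : ∀ p : ℤ × ℤ, ‖z‖ ^ 3 * ‖((p.1 : ℂ) + p.2 * τ)⁻¹‖ ^ 3 =
      ‖z / ((p.1 : ℂ) + p.2 * τ)‖ ^ 3 := fun p ↦ by rw [div_eq_mul_inv, norm_mul, mul_pow]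
  simp only [hs] at h
  refine Summable.of_norm_bounded_eventually (h.mul_left (Real.exp 2)) ?_
  filter_upwards [h.tendsto_cofinite_zero.eventually (ge_mem_nhds one_pos)] with p hp
  rw [norm_norm]
  exact norm_primaryFactor_sub_one_le
    ((pow_le_one_iff_of_nonneg (norm_nonneg _) three_ne_zero).mp hp)

lemma multipliable_primaryFactor_lattice {τ : ℂ} (hτ : 0 < τ.im) (z : ℂ) :
    Multipliable fun p : ℤ × ℤ ↦ primaryFactor (z / ((p.1 : ℂ) + p.2 * τ)) := by
  simpa using multipliable_one_add_of_summable (summable_norm_primaryFactor_sub_one hτ z)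

lemma multipliable_primaryFactor_row {τ : ℂ} (hτ : 0 < τ.im) (z : ℂ) (n : ℤ) :
    Multipliable fun m : ℤ ↦ primaryFactor (z / ((m : ℂ) + n * τ)) := by
  have h := (summable_norm_primaryFactor_sub_one hτ z).comp_injective
    (i := fun m : ℤ ↦ (m, n)) fun a b hab ↦ congrArg Prod.fst hab
  simpa using multipliable_one_add_of_summable h

lemma wSigma_one_eq_mul_tprod (τ z : ℂ) :
    wSigma 1 τ z = z * ∏' p : ℤ × ℤ, primaryFactor (z / ((p.1 : ℂ) + p.2 * τ)) := by
  have hsub : Function.mulSupport (fun p : ℤ × ℤ ↦ primaryFactor (z / ((p.1 : ℂ) + p.2 * τ))) ⊆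
      {p : ℤ × ℤ | p ≠ 0} := by
    rintro p hp rfl
    simp [primaryFactor_zero] at hp
  rw [wSigma, ← tprod_subtype_eq_of_mulSupport_subset hsub]
  congr 1
  refine tprod_congr fun p ↦ ?_
  simp only [primaryFactor, mul_one]
  rw [div_pow, div_div, mul_comm 2]

lemma hasProd_tprod_primaryFactor_row {τ : ℂ} (hτ : 0 < τ.im) (z : ℂ) :
    HasProd (fun n : ℤ ↦ ∏' m : ℤ, primaryFactor (z / ((m : ℂ) + n * τ)))
      (∏' p : ℤ × ℤ, primaryFactor (z / ((p.1 : ℂ) + p.2 * τ))) := by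
  have h := (multipliable_primaryFactor_lattice hτ z).hasProd
  rw [← (Equiv.prodComm ℤ ℤ).hasProd_iff] at h
  exact h.prod_fiberwise fun n ↦ (multipliable_primaryFactor_row hτ z n).hasProd

@[to_additive]
lemma prod_Icc_neg_eq_mul_prod_range {M : Type*} [CommMonoid M] (f : ℤ → M) (N : ℕ) :
    ∏ n ∈ Icc (-N : ℤ) N, f n = f 0 * ∏ k ∈ range N, (f (k + 1) * f (-(k + 1))) := by
  induction N with
  | zero => simp
  | succ N ih =>
    have hI : Icc (-(N + 1 : ℕ) : ℤ) (N + 1 : ℕ) =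
        insert ((N : ℤ) + 1) (insert (-((N : ℤ) + 1)) (Icc (-N : ℤ) N)) := by
      ext n
      simp only [mem_Icc, mem_insert]
      lia
    rw [hI, prod_insert, prod_insert, ih, prod_range_succ]
    · rw [← mul_assoc (f (N + 1)), mul_comm, mul_assoc]
    · simp
    · simp only [mem_Icc, mem_insert]
      lia

@[to_additive]
lemma HasProd.tendsto_mul_prod_range_int {M : Type*} [CommMonoid M] [TopologicalSpace M]
    {f : ℤ → M} {a : M} (hf : HasProd f a) :
    Tendsto (fun N : ℕ ↦ f 0 * ∏ k ∈ range N, (f (k + 1) * f (-(k + 1)))) atTop (𝓝 a) := by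
  have h : Tendsto (fun s : Finset ℤ ↦ ∏ n ∈ s, f n) atTop (𝓝 a) := by
    simpa [HasProd] using hf
  exact (h.comp (tendsto_Icc_neg (R := ℤ))).congr fun N ↦ prod_Icc_neg_eq_mul_prod_range f N

lemma summable_one_div_int_add_sq (α : ℂ) : Summable fun m : ℤ ↦ 1 / ((m : ℂ) + α) ^ 2 := by
  refine (EisensteinSeries.linear_right_summable α 1 (k := 2) le_rfl).congr fun m ↦ ?_
  rw [one_div, Int.cast_one, one_mul, add_comm]
  norm_cast

lemma primaryFactor_mul_prod_range_eq {α : ℂ} (hα : α ∈ integerComplement) (z : ℂ) (N : ℕ) :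
    primaryFactor (z / α) * ∏ k ∈ range N, (primaryFactor (z / (((k + 1 : ℤ) : ℂ) + α)) *
      primaryFactor (z / (((-(k + 1) : ℤ) : ℂ) + α))) =
    ((π * (α - z) * ∏ k ∈ range N, (1 - (α - z) ^ 2 / ((k : ℂ) + 1) ^ 2)) /
      (π * α * ∏ k ∈ range N, (1 - α ^ 2 / ((k : ℂ) + 1) ^ 2))) *
    cexp (z * (1 / α + ∑ k ∈ range N, cotTerm α k) + z ^ 2 / 2 * (1 / α ^ 2 +
      ∑ k ∈ range N, (1 / (((k + 1 : ℤ) : ℂ) + α) ^ 2 + 1 / (((-(k + 1) : ℤ) : ℂ) + α) ^ 2))) := by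
  have hα0 := integerComplement.ne_zero hα
  have hπ : (π : ℂ) ≠ 0 := by exact_mod_cast Real.pi_ne_zero
  induction N with
  | zero =>
    simp only [primaryFactor, range_zero, prod_empty, sum_empty, mul_one, add_zero]
    congr 1
    · field_simp
    · congr 1
      ring
  | succ N ih =>
    rw [prod_range_succ, ← mul_assoc, ih, prod_range_succ, prod_range_succ, sum_range_succ,
      sum_range_succ]
    have h1 : ((N : ℂ) + 1) + α ≠ 0 := by
      have := integerComplement_add_ne_zero hα (N + 1)
      push_cast at this
      rwa [add_comm]
    have h2 : -((N : ℂ) + 1) + α ≠ 0 := by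
      have := integerComplement_add_ne_zero hα (-(N + 1))
      push_cast at this
      rwa [add_comm]
    have h3 : (N : ℂ) + 1 ≠ 0 := Nat.cast_add_one_ne_zero N
    have h4 : (1 - α ^ 2 / ((N : ℂ) + 1) ^ 2) ≠ 0 := by
      have : (1 - α ^ 2 / ((N : ℂ) + 1) ^ 2) =
          -((((N : ℂ) + 1) + α) * (-((N : ℂ) + 1) + α)) / ((N : ℂ) + 1) ^ 2 := by
        field_simp
        ring
      rw [this]
      exact div_ne_zero (neg_ne_zero.mpr (mul_ne_zero h1 h2)) (pow_ne_zero 2 h3)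
    have hfac : (1 - z / ((N : ℂ) + 1 + α)) * (1 - z / (-((N : ℂ) + 1) + α)) =
        (1 - (α - z) ^ 2 / ((N : ℂ) + 1) ^ 2) / (1 - α ^ 2 / ((N : ℂ) + 1) ^ 2) := by
      rw [eq_div_iff h4]
      field_simp
      ring
    have hcot : cotTerm α N = 1 / (-((N : ℂ) + 1) + α) + 1 / ((N : ℂ) + 1 + α) := by
      rw [cotTerm]; ring
    have hexp : cexp (z * (1 / α + (∑ k ∈ range N, cotTerm α k + cotTerm α N)) +
        z ^ 2 / 2 * (1 / α ^ 2 + (∑ k ∈ range N,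
          (1 / (((k + 1 : ℤ) : ℂ) + α) ^ 2 + 1 / (((-(k + 1) : ℤ) : ℂ) + α) ^ 2) +
          (1 / (((N + 1 : ℤ) : ℂ) + α) ^ 2 + 1 / (((-(N + 1) : ℤ) : ℂ) + α) ^ 2)))) =
        cexp (z * (1 / α + ∑ k ∈ range N, cotTerm α k) + z ^ 2 / 2 * (1 / α ^ 2 +
          ∑ k ∈ range N,
            (1 / (((k + 1 : ℤ) : ℂ) + α) ^ 2 + 1 / (((-(k + 1) : ℤ) : ℂ) + α) ^ 2))) *
        (cexp (z / ((N : ℂ) + 1 + α) + (z / ((N : ℂ) + 1 + α)) ^ 2 / 2) *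
          cexp (z / (-((N : ℂ) + 1) + α) + (z / (-((N : ℂ) + 1) + α)) ^ 2 / 2)) := by
      rw [← Complex.exp_add, ← Complex.exp_add, hcot]
      congr 1
      push_cast
      rw [div_pow, div_pow]
      ring
    rw [hexp, ← mul_assoc (π * (α - z)), ← mul_assoc (π * α),
      mul_div_mul_comm _ (1 - (α - z) ^ 2 / ((N : ℂ) + 1) ^ 2), ← hfac]
    simp only [primaryFactor]
    push_cast
    ring

lemma tendsto_primaryFactor_mul_prod_range {α : ℂ} (hα : α ∈ integerComplement) (z : ℂ) :
    Tendsto (fun N : ℕ ↦ primaryFactor (z / α) * ∏ k ∈ range N,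
      (primaryFactor (z / (((k + 1 : ℤ) : ℂ) + α)) *
        primaryFactor (z / (((-(k + 1) : ℤ) : ℂ) + α)))) atTop
      (𝓝 (sin (π * (α - z)) / sin (π * α) *
        cexp (z * (π * cot (π * α)) + z ^ 2 / 2 * ∑' m : ℤ, 1 / ((m : ℂ) + α) ^ 2))) := by
  simp only [primaryFactor_mul_prod_range_eq hα]
  refine ((Complex.tendsto_euler_sin_prod (α - z)).div (Complex.tendsto_euler_sin_prod α)
    (sin_pi_mul_ne_zero hα)).mul (Tendsto.cexp ?_)
  refine ((?_ : Tendsto _ _ _).const_mul z).add ((?_ : Tendsto _ _ _).const_mul _)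
  · have h := (tendsto_logDeriv_euler_cot_sub hα).const_add (1 / α)
    rwa [add_sub_cancel] at h
  · simpa using (summable_one_div_int_add_sq α).hasSum.tendsto_add_sum_range_int

lemma tprod_primaryFactor_row {τ : ℂ} (hτ : 0 < τ.im) (z : ℂ) {n : ℤ}
    (hn : (n : ℂ) * τ ∈ integerComplement) :
    ∏' m : ℤ, primaryFactor (z / ((m : ℂ) + n * τ)) =
      sin (π * (n * τ - z)) / sin (π * (n * τ)) * cexp (z * (π * cot (π * (n * τ))) +
        z ^ 2 / 2 * ∑' m : ℤ, 1 / ((m : ℂ) + n * τ) ^ 2) := by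
  refine tendsto_nhds_unique
    (multipliable_primaryFactor_row hτ z n).hasProd.tendsto_mul_prod_range_int
    ((tendsto_primaryFactor_mul_prod_range hn z).congr fun N ↦ ?_)
  rw [Int.cast_zero, zero_add]

lemma mul_tprod_primaryFactor_row_zero {τ : ℂ} (hτ : 0 < τ.im) (z : ℂ) :
    z * ∏' m : ℤ, primaryFactor (z / ((m : ℂ) + (0 : ℤ) * τ)) =
      sin (π * z) / π * cexp (z ^ 2 / 2 * ∑' m : ℤ, 1 / ((m : ℂ) + (0 : ℤ) * τ) ^ 2) := by
  have hπ : (π : ℂ) ≠ 0 := by exact_mod_cast Real.pi_ne_zero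
  have h1 := (multipliable_primaryFactor_row hτ z 0).hasProd.tendsto_mul_prod_range_int.const_mul z
  have h2 := (summable_one_div_int_add_sq ((0 : ℤ) * τ)).hasSum.tendsto_add_sum_range_int
  refine tendsto_nhds_unique h1 ((((Complex.tendsto_euler_sin_prod z).div_const (π : ℂ)).mul
    (h2.const_mul (z ^ 2 / 2)).cexp).congr fun N ↦ ?_)
  simp only [Int.cast_zero, zero_mul, add_zero, div_zero, primaryFactor_zero, one_mul, ne_eq,
    OfNat.ofNat_ne_zero, not_false_eq_true, zero_pow, zero_add]
  rw [mul_assoc, mul_div_cancel_left₀ _ hπ, mul_assoc]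
  congr 1
  rw [mul_sum, Complex.exp_sum, ← prod_mul_distrib]
  refine prod_congr rfl fun k _ ↦ ?_
  have h3 : (k : ℂ) + 1 ≠ 0 := Nat.cast_add_one_ne_zero k
  simp only [primaryFactor]
  rw [mul_mul_mul_comm, ← Complex.exp_add]
  push_cast
  congr 1
  · field_simp
    ring
  · congr 1
    field_simp
    ring

lemma int_mul_mem_integerComplement {τ : ℂ} (hτ : 0 < τ.im) {n : ℤ} (hn : n ≠ 0) :
    (n : ℂ) * τ ∈ integerComplement := by
  rw [mem_integerComplement_iff]
  rintro ⟨m, hm⟩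
  have h := congrArg Complex.im hm
  simp [hτ.ne', hn] at h

lemma sin_div_sin_mul_sin_div_sin {α : ℂ} (hα : sin (π * α) ≠ 0) (z : ℂ) :
    sin (π * (α - z)) / sin (π * α) * (sin (π * (-α - z)) / sin (π * -α)) =
      (1 - cexp (2 * π * I * α) * cexp (2 * π * I * z)) *
        (1 - cexp (2 * π * I * α) / cexp (2 * π * I * z)) / (1 - cexp (2 * π * I * α)) ^ 2 := by
  have ha0 := exp_ne_zero (π * I * α)
  have hb0 := exp_ne_zero (π * I * z)
  have hA : cexp (2 * π * I * α) = cexp (π * I * α) ^ 2 := by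
    rw [← Complex.exp_nat_mul]; push_cast; ring_nf
  have hB : cexp (2 * π * I * z) = cexp (π * I * z) ^ 2 := by
    rw [← Complex.exp_nat_mul]; push_cast; ring_nf
  have h1 : sin (π * α) = ((cexp (π * I * α))⁻¹ - cexp (π * I * α)) * I / 2 := by
    rw [Complex.sin, ← Complex.exp_neg]; ring_nf
  have h2 : sin (π * (α - z)) = (cexp (π * I * z) / cexp (π * I * α) -
      cexp (π * I * α) / cexp (π * I * z)) * I / 2 := by
    rw [Complex.sin, ← Complex.exp_sub, ← Complex.exp_sub]; ring_nf
  have h3 : sin (π * (-α - z)) = (cexp (π * I * α) * cexp (π * I * z) -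
      (cexp (π * I * α) * cexp (π * I * z))⁻¹) * I / 2 := by
    rw [Complex.sin, ← Complex.exp_add, ← Complex.exp_neg]; ring_nf
  rw [mul_neg, Complex.sin_neg, hA, hB]
  rw [h1] at hα
  rw [h1, h2, h3]
  have h4 : 1 - cexp (π * I * α) ^ 2 ≠ 0 := by
    contrapose! hα
    have : (cexp (π * I * α))⁻¹ - cexp (π * I * α) =
        (1 - cexp (π * I * α) ^ 2) * (cexp (π * I * α))⁻¹ := by
      field_simp
    rw [this, hα]
    simp
  generalize cexp (π * I * α) = a at *
  generalize cexp (π * I * z) = b at *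
  have h5 : (a⁻¹ - a) = (1 - a ^ 2) / a := by field_simp
  rw [h5]
  field_simp
  ring

lemma tprod_primaryFactor_row_mul_neg {τ : ℂ} (hτ : 0 < τ.im) (z : ℂ) (k : ℕ) :
    (∏' m : ℤ, primaryFactor (z / ((m : ℂ) + (k + 1 : ℤ) * τ))) *
      (∏' m : ℤ, primaryFactor (z / ((m : ℂ) + (-(k + 1) : ℤ) * τ))) =
      (1 - (cexp (π * I * τ) ^ 2) ^ (k + 1) * cexp (2 * π * I * z)) *
        (1 - (cexp (π * I * τ) ^ 2) ^ (k + 1) / cexp (2 * π * I * z)) /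
          (1 - (cexp (π * I * τ) ^ 2) ^ (k + 1)) ^ 2 *
      cexp (z ^ 2 / 2 * (∑' m : ℤ, 1 / ((m : ℂ) + (k + 1 : ℤ) * τ) ^ 2 +
        ∑' m : ℤ, 1 / ((m : ℂ) + (-(k + 1) : ℤ) * τ) ^ 2)) := by
  have hk := int_mul_mem_integerComplement hτ (n := k + 1) (by lia)
  have hk' := int_mul_mem_integerComplement hτ (n := -(k + 1)) (by lia)
  rw [tprod_primaryFactor_row hτ z hk, tprod_primaryFactor_row hτ z hk']
  have hA : (cexp (π * I * τ) ^ 2) ^ (k + 1) = cexp (2 * π * I * ((k + 1 : ℤ) * τ)) := by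
    rw [← pow_mul, ← Complex.exp_nat_mul]; push_cast; ring_nf
  have hneg : ((-(k + 1) : ℤ) : ℂ) * τ = -(((k + 1 : ℤ) : ℂ) * τ) := by push_cast; ring
  rw [mul_mul_mul_comm, ← Complex.exp_add, hA, hneg,
    sin_div_sin_mul_sin_div_sin (sin_pi_mul_ne_zero hk)]
  congr 2
  rw [mul_neg, Complex.cot, Complex.cot, Complex.cos_neg, Complex.sin_neg, div_neg]
  ring

lemma tendsto_wSigma_one {τ : ℂ} (hτ : 0 < τ.im) (z : ℂ) :
    Tendsto (fun N : ℕ ↦ sin (π * z) / π *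
      (evenProd (cexp (π * I * τ) ^ 2) (cexp (2 * π * I * z)) N /
        eulerProd (cexp (π * I * τ) ^ 2) N ^ 2) *
      cexp (z ^ 2 / 2 * (∑' m : ℤ, 1 / ((m : ℂ) + (0 : ℤ) * τ) ^ 2 +
        ∑ k ∈ range N, (∑' m : ℤ, 1 / ((m : ℂ) + (k + 1 : ℤ) * τ) ^ 2 +
          ∑' m : ℤ, 1 / ((m : ℂ) + (-(k + 1) : ℤ) * τ) ^ 2)))) atTop (𝓝 (wSigma 1 τ z)) := by
  rw [wSigma_one_eq_mul_tprod]
  refine ((hasProd_tprod_primaryFactor_row hτ z).tendsto_mul_prod_range_int.const_mul z).congr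
    fun N ↦ ?_
  simp only [tprod_primaryFactor_row_mul_neg hτ]
  rw [← mul_assoc, mul_tprod_primaryFactor_row_zero hτ, prod_mul_distrib, prod_div_distrib,
    prod_pow, ← Complex.exp_sum, mul_add (z ^ 2 / 2), Complex.exp_add, mul_sum]
  simp only [evenProd, eulerProd]
  ring

lemma tsum_one_div_int_add_neg_mul_sq (n : ℤ) (τ : ℂ) :
    ∑' m : ℤ, 1 / ((m : ℂ) + (-n : ℤ) * τ) ^ 2 = ∑' m : ℤ, 1 / ((m : ℂ) + n * τ) ^ 2 := by
  rw [← (Equiv.neg ℤ).tsum_eq]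
  refine tsum_congr fun m ↦ ?_
  simp only [Equiv.neg_apply, Int.cast_neg]
  rw [← neg_sq]
  congr 2
  ring

lemma summable_tsum_one_div_int_add_mul_sq {τ : ℂ} (hτ : 0 < τ.im) :
    Summable fun n : ℤ ↦ ∑' m : ℤ, 1 / ((m : ℂ) + n * τ) ^ 2 := by
  have hnat : Summable fun k : ℕ ↦ ∑' m : ℤ, 1 / ((m : ℂ) + (k + 1 : ℤ) * τ) ^ 2 := by
    have h1 : Summable fun k : ℕ ↦
        ∑' c : ℕ+, (c : ℂ) * cexp (2 * π * I * τ) ^ ((k + 1) * c : ℕ) := by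
      rw [← summable_pnat_iff_summable_succ
        (f := fun b ↦ ∑' c : ℕ+, (c : ℂ) * cexp (2 * π * I * τ) ^ (b * c : ℕ))]
      apply (summable_prod_mul_pow 1 (UpperHalfPlane.norm_exp_two_pi_I_lt_one ⟨τ, hτ⟩)).prod.congr
      simp
    refine (h1.mul_left ((-2 * π * I) ^ 2)).congr fun k ↦ ?_
    have him : 0 < (((k + 1 : ℤ) : ℂ) * τ).im := by
      simp
      positivity
    have h2 := EisensteinSeries.qExpansion_identity_pnat (k := 1) le_rfl ⟨_, him⟩
    simp only [Nat.factorial_one, Nat.cast_one, div_one, pow_one, Nat.reduceAdd] at h2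
    simp only [add_comm _ (((k + 1 : ℤ) : ℂ) * τ)]
    refine Eq.trans ?_ h2.symm
    congr 1
    refine tsum_congr fun c ↦ ?_
    rw [← Complex.exp_nat_mul, ← Complex.exp_nat_mul]
    push_cast
    ring_nf
  refine Summable.of_add_one_of_neg_add_one hnat ?_
  simpa only [tsum_one_div_int_add_neg_mul_sq] using hnat

lemma tendsto_delta2 {τ : ℂ} (hτ : 0 < τ.im) :
    Tendsto (fun N : ℕ ↦ ∑' m : ℤ, 1 / ((m : ℂ) + (0 : ℤ) * τ) ^ 2 +
        ∑ k ∈ range N, (∑' m : ℤ, 1 / ((m : ℂ) + (k + 1 : ℤ) * τ) ^ 2 +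
          ∑' m : ℤ, 1 / ((m : ℂ) + (-(k + 1) : ℤ) * τ) ^ 2)) atTop (𝓝 (delta2 τ)) := by
  have h : delta2 τ = ∑' n : ℤ, ∑' m : ℤ, 1 / ((m : ℂ) + n * τ) ^ 2 := by
    refine tsum_congr fun n ↦ tsum_congr fun m ↦ ?_
    split_ifs with hmn
    · obtain ⟨rfl, rfl⟩ := Prod.mk.inj hmn
      simp
    · rfl
  rw [h]
  exact (summable_tsum_one_div_int_add_mul_sq hτ).hasSum.tendsto_add_sum_range_int

/-- σ(2z, τ) as a product of the four theta functions. -/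
theorem sigma_two_mul_theta (τ : ℂ) (hτ : 0 < τ.im) (z : ℂ) :
    wSigma 1 τ (2 * z) =
      2 / ((Real.pi : ℂ) * (theta2 0 τ) ^ 2 * (theta3 0 τ) ^ 2 * (theta4 0 τ) ^ 2) *
        Complex.exp (2 * delta2 τ * z ^ 2) *
        (theta1 ((Real.pi : ℂ) * z) τ * theta2 ((Real.pi : ℂ) * z) τ *
          theta3 ((Real.pi : ℂ) * z) τ * theta4 ((Real.pi : ℂ) * z) τ) := by
  obtain ⟨G, hG0, hG⟩ := exists_tendsto_eulerProd (norm_nome_sq_lt_one hτ)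
  have hc0 := exp_ne_zero (π * I * τ / 4)
  have hπ : (π : ℂ) ≠ 0 := by exact_mod_cast Real.pi_ne_zero
  have h2 : Tendsto (fun N : ℕ ↦ 2 * N) atTop atTop := tendsto_id.const_mul_atTop' two_pos
  have hlim := ((tendsto_theta_mul_theta_mul_theta_mul_theta hτ z).div
    (((hG.pow 4).mul ((hG.comp h2).pow 2)).const_mul (2 * π * cexp (π * I * τ / 4) ^ 2))
    (by simp [hG0, hc0, hπ])).mul (((tendsto_delta2 hτ).comp h2).const_mul ((2 * z) ^ 2 / 2)).cexp
  have heq := tendsto_nhds_unique (((tendsto_wSigma_one hτ (2 * z)).comp h2).congr fun N ↦ ?_) hlim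
  · have hden : (π : ℂ) * theta2 0 τ ^ 2 * theta3 0 τ ^ 2 * theta4 0 τ ^ 2 =
        π * (2 * cexp (π * I * τ / 4) * G ^ 3) ^ 2 := by
      rw [← theta2_mul_theta3_mul_theta4_zero hτ hG]
      ring
    rw [heq, hden, show (2 * z) ^ 2 / 2 * delta2 τ = 2 * delta2 τ * z ^ 2 by ring]
    field_simp
  · have hP := eulerProd_ne_zero (norm_nome_sq_lt_one hτ)
    have hP1 := hP N
    have hP2 := hP (2 * N)
    simp only [Function.comp_apply, Pi.div_apply]
    congr 1
    rw [show (π : ℂ) * (2 * z) = 2 * π * z by ring]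
    field_simp
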